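/- For any 3-graph F and any vertex v ∈ V(F), the 3-graph F is layered if and only if the linearized 3-graph F_v is layered. -/

import Mathlib

open Finset

structure ThreeGraph (V : Type*) where
  edges : Finset (Finset V)
  card_eq : ∀ e ∈ edges, e.card = 3

variable {α β : Type*}

/-- `H` contains a copy of `F`. -/
def HasCopy [DecidableEq β] (H : ThreeGraph β) (F : ThreeGraph α) : Prop :=
  ∃ φ : α → β, Function.Injective φ ∧ ∀ e ∈ F.edges, e.image φ ∈ H.edges

/-- The codegree of a pair of vertices. -/
def codeg [DecidableEq β] [Fintype β] (H : ThreeGraph β) (u v : β) : ℕ :=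
  (Finset.univ.filter (fun w => ({u, v, w} : Finset β) ∈ H.edges)).card

/-- The codegree Turán density of a 3-graph `F`. -/
noncomputable def piCo (F : ThreeGraph α) : ℝ :=
  sSup {x : ℝ | 0 ≤ x ∧ x ≤ 1 ∧ ∀ n₀ : ℕ, ∃ n : ℕ, n₀ ≤ n ∧ ∃ H : ThreeGraph (Fin n),
    ¬ HasCopy H F ∧ ∀ u v : Fin n, u ≠ v → x * n ≤ (codeg H u v : ℝ)}

/-- An `n`-vertex 3-graph is uniformly `(d, η)`-dense. -/
def UniformlyDense {n : ℕ} (H : ThreeGraph (Fin n)) (d η : ℝ) : Prop :=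
  ∀ U : Finset (Fin n),
    d * (U.card.choose 3 : ℝ) - η * (n : ℝ) ^ 3 ≤ ((H.edges.filter (fun e => e ⊆ U)).card : ℝ)

/-- The uniform Turán density of a 3-graph `F`. -/
noncomputable def piUnif (F : ThreeGraph α) : ℝ :=
  sSup {d : ℝ | 0 ≤ d ∧ d ≤ 1 ∧ ∀ η : ℝ, 0 < η → ∀ n₀ : ℕ, ∃ n : ℕ, n₀ ≤ n ∧
    ∃ H : ThreeGraph (Fin n), ¬ HasCopy H F ∧ UniformlyDense H d η}

/-- `f` is a layered function of the 3-graph with edge set `E`. -/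
def IsLayeredFunction [DecidableEq α] (E : Finset (Finset α)) (f : α → ℕ) : Prop :=
  (∀ e ∈ E, ∃ w ∈ e, ∀ u ∈ e, u ≠ w → f u < f w) ∧
  (∀ e₁ ∈ E, ∀ e₂ ∈ E, e₁.sup f = e₂.sup f → Multiset.map f e₁.val = Multiset.map f e₂.val) ∧
  (∀ e₁ ∈ E, ∀ e₂ ∈ E, ∀ u v w u' v' w' : α,
    u ≠ v → u ≠ w → v ≠ w → u' ≠ v' → u' ≠ w' → v' ≠ w' →
    e₁ = {u, v, w} → e₂ = {u', v', w'} →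
    f u = f u' → f v = f v' → f w = f w')

/-- A 3-graph is layered if it admits a layered function. -/
def IsLayered [DecidableEq α] (F : ThreeGraph α) : Prop :=
  ∃ f : α → ℕ, IsLayeredFunction F.edges f

/-- The edges of the link graph of `v` in `F`, as 2-element subsets of the vertex set. -/
def linkPairs [DecidableEq α] (F : ThreeGraph α) (v : α) : Finset (Finset α) :=
  (F.edges.filter (fun e => v ∈ e)).image (fun e => e.erase v)

/-- The vertex set of the linearization `F_v`: the original vertices other than `v`,
together with, for each link pair `p = {u,w}`, four new vertices `v_p, x_p, y_p, z_p`
(indexed by `Fin 4`), and three new vertices `x_v, y_v, z_v` (indexed by `Fin 3`). -/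
abbrev LinVert {α : Type*} [DecidableEq α] (F : ThreeGraph α) (v : α) : Type _ :=
  {x : α // x ≠ v} ⊕ ((Fin 4 × {p : Finset α // p ∈ linkPairs F v}) ⊕ Fin 3)

/-- `G` is the linearization `F_v` of `F` at the vertex `v`: its edges are the edges of `F`
avoiding `v`; for each link pair `p = {u,w}` of `v` the edge `{u, w, v_p}`; and for each
link pair `p` the six edges of a Fano plane minus an edge on
`{x_v, y_v, z_v, v_p, x_p, y_p, z_p}`. -/
def IsLinearization {α : Type*} [DecidableEq α] (F : ThreeGraph α) (v : α)
    (G : ThreeGraph (LinVert F v)) : Prop :=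
  ∀ e : Finset (LinVert F v), e ∈ G.edges ↔
    ((∃ e₀ ∈ F.edges, v ∉ e₀ ∧ e = (e₀.subtype (fun x => x ≠ v)).image Sum.inl) ∨
      (∃ p : {p : Finset α // p ∈ linkPairs F v},
        e = insert (Sum.inr (Sum.inl (0, p))) ((p.val.subtype (fun x => x ≠ v)).image Sum.inl) ∨
        e = {Sum.inr (Sum.inr 0), Sum.inr (Sum.inl (0, p)), Sum.inr (Sum.inl (1, p))} ∨
        e = {Sum.inr (Sum.inr 0), Sum.inr (Sum.inl (2, p)), Sum.inr (Sum.inl (3, p))} ∨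
        e = {Sum.inr (Sum.inr 1), Sum.inr (Sum.inl (0, p)), Sum.inr (Sum.inl (2, p))} ∨
        e = {Sum.inr (Sum.inr 1), Sum.inr (Sum.inl (1, p)), Sum.inr (Sum.inl (3, p))} ∨
        e = {Sum.inr (Sum.inr 2), Sum.inr (Sum.inl (0, p)), Sum.inr (Sum.inl (3, p))} ∨
        e = {Sum.inr (Sum.inr 2), Sum.inr (Sum.inl (1, p)), Sum.inr (Sum.inl (2, p))}))

theorem multiset_triple_eq_iff {γ : Type*} (a b c x y z : γ) :
    ({a, b, c} : Multiset γ) = {x, y, z} ↔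
      (a = x ∧ b = y ∧ c = z) ∨ (a = x ∧ b = z ∧ c = y) ∨ (a = y ∧ b = x ∧ c = z) ∨
      (a = y ∧ b = z ∧ c = x) ∨ (a = z ∧ b = x ∧ c = y) ∨ (a = z ∧ b = y ∧ c = x) := by
  classical
  constructor
  · intro h
    have ha : a ∈ ({x, y, z} : Multiset γ) := by rw [← h]; simp
    have pair_eq : ∀ {p q r s : γ}, ({p, q} : Multiset γ) = {r, s} →
        (p = r ∧ q = s) ∨ (p = s ∧ q = r) := by
      intro p q r s hpq
      have hp : p ∈ ({r, s} : Multiset γ) := by rw [← hpq]; simp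
      simp only [Multiset.insert_eq_cons, Multiset.mem_cons, Multiset.mem_singleton] at hp
      rcases hp with rfl | rfl
      · exact Or.inl ⟨rfl, by simpa using hpq⟩
      · rw [Multiset.pair_comm r p] at hpq
        exact Or.inr ⟨rfl, by simpa using hpq⟩
    simp only [Multiset.insert_eq_cons, Multiset.mem_cons, Multiset.mem_singleton] at ha h
    rcases ha with rfl | rfl | rfl
    · have := pair_eq ((Multiset.cons_inj_right _).1 h)
      tauto
    · rw [Multiset.cons_swap x] at h
      have := pair_eq ((Multiset.cons_inj_right _).1 h)
      tauto
    · have hz : x ::ₘ y ::ₘ ({a} : Multiset γ) = a ::ₘ x ::ₘ {y} := by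
        rw [← Multiset.insert_eq_cons y, Multiset.pair_comm y a, Multiset.insert_eq_cons,
          Multiset.cons_swap]
      rw [hz] at h
      have := pair_eq ((Multiset.cons_inj_right _).1 h)
      tauto
  · rintro (⟨rfl, rfl, rfl⟩ | ⟨rfl, rfl, rfl⟩ | ⟨rfl, rfl, rfl⟩ | ⟨rfl, rfl, rfl⟩ |
      ⟨rfl, rfl, rfl⟩ | ⟨rfl, rfl, rfl⟩) <;>
      first
      | rfl
      | ext t
        simp only [Multiset.insert_eq_cons, Multiset.count_cons, Multiset.count_singleton]
        omega

/-- The multisets of `f`-values of the edges of `E`. -/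
def edgeValues (E : Finset (Finset α)) (f : α → ℕ) : Set (Multiset ℕ) :=
  {s | ∃ e ∈ E, Multiset.map f e.val = s}

/-- The conditions on a layered function, read off from the multisets of values of the edges. -/
structure IsLayeredValues (S : Set (Multiset ℕ)) : Prop where
  strict : ∀ {a b c : ℕ}, {a, b, c} ∈ S → (a < c ∧ b < c) ∨ (a < b ∧ c < b) ∨ (b < a ∧ c < a)
  top : ∀ {a b c a' b' : ℕ}, {a, b, c} ∈ S → {a', b', c} ∈ S → a < c → b < c → a' < c → b' < c →
    (a = a' ∧ b = b') ∨ (a = b' ∧ b = a')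
  third : ∀ {a b c d : ℕ}, {a, b, c} ∈ S → {a, b, d} ∈ S → c = d

theorem IsLayeredValues.mono {S T : Set (Multiset ℕ)} (hT : IsLayeredValues T) (h : S ⊆ T) :
    IsLayeredValues S :=
  ⟨fun h₁ => hT.strict (h h₁), fun h₁ h₂ => hT.top (h h₁) (h h₂),
    fun h₁ h₂ => hT.third (h h₁) (h h₂)⟩

theorem map_val_triple [DecidableEq α] (f : α → ℕ) {u v w : α} (huv : u ≠ v) (huw : u ≠ w)
    (hvw : v ≠ w) : Multiset.map f ({u, v, w} : Finset α).val = {f u, f v, f w} := by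
  rw [Finset.insert_val_of_notMem (by simp [huv, huw]),
    Finset.insert_val_of_notMem (by simp [hvw])]
  simp

theorem exists_vertices_of_map_eq [DecidableEq α] (e : Finset α) (f : α → ℕ) {a b c : ℕ}
    (h : Multiset.map f e.val = {a, b, c}) :
    ∃ u v w, u ≠ v ∧ u ≠ w ∧ v ≠ w ∧ e = {u, v, w} ∧ f u = a ∧ f v = b ∧ f w = c := by
  have hcard : e.card = 3 := by
    have := congrArg Multiset.card h
    simpa using this
  obtain ⟨x, y, z, hxy, hxz, hyz, rfl⟩ := Finset.card_eq_three.1 hcard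
  rw [map_val_triple f hxy hxz hyz, multiset_triple_eq_iff] at h
  rcases h with h | h | h | h | h | h
  · exact ⟨x, y, z, hxy, hxz, hyz, rfl, h⟩
  · exact ⟨x, z, y, hxz, hxy, hyz.symm, by grind, h.1, h.2.2, h.2.1⟩
  · exact ⟨y, x, z, hxy.symm, hyz, hxz, by grind, h.2.1, h.1, h.2.2⟩
  · exact ⟨z, x, y, hxz.symm, hyz.symm, hxy, by grind, h.2.2, h.1, h.2.1⟩
  · exact ⟨y, z, x, hyz, hxy.symm, hxz.symm, by grind, h.2.1, h.2.2, h.1⟩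
  · exact ⟨z, y, x, hyz.symm, hxz.symm, hxy.symm, by grind, h.2.2, h.2.1, h.1⟩

theorem isLayeredFunction_iff [DecidableEq α] (F : ThreeGraph α) (f : α → ℕ) :
    IsLayeredFunction F.edges f ↔ IsLayeredValues (edgeValues F.edges f) := by
  constructor
  · rintro ⟨h₁, h₂, h₃⟩
    refine ⟨?_, ?_, ?_⟩
    · rintro a b c ⟨e, he, hs⟩
      obtain ⟨u, v, w, huv, huw, hvw, rfl, rfl, rfl, rfl⟩ := exists_vertices_of_map_eq e f hs
      obtain ⟨t, ht, hmax⟩ := h₁ _ he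
      have hu := hmax u (by simp)
      have hv := hmax v (by simp)
      have hw := hmax w (by simp)
      simp only [Finset.mem_insert, Finset.mem_singleton] at ht
      clear h₁ h₂ h₃ hmax
      grind
    · rintro a b c a' b' ⟨e, he, hs⟩ ⟨e', he', hs'⟩ hac hbc hac' hbc'
      obtain ⟨u, v, w, huv, huw, hvw, rfl, rfl, rfl, rfl⟩ := exists_vertices_of_map_eq e f hs
      obtain ⟨u', v', w', huv', huw', hvw', rfl, rfl, rfl, hw⟩ :=
        exists_vertices_of_map_eq e' f hs'
      have := h₂ _ he _ he' (by simp [Finset.sup_insert]; omega)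
      rw [hs, hs', multiset_triple_eq_iff] at this
      omega
    · rintro a b c d ⟨e, he, hs⟩ ⟨e', he', hs'⟩
      obtain ⟨u, v, w, huv, huw, hvw, heq, hu, hv, rfl⟩ := exists_vertices_of_map_eq e f hs
      obtain ⟨u', v', w', huv', huw', hvw', heq', hu', hv', rfl⟩ :=
        exists_vertices_of_map_eq e' f hs'
      exact h₃ e he e' he' u v w u' v' w' huv huw hvw huv' huw' hvw' heq heq'
        (hu.trans hu'.symm) (hv.trans hv'.symm)
  · intro h
    have exists_top : ∀ e ∈ F.edges, ∃ u v w, u ≠ v ∧ u ≠ w ∧ v ≠ w ∧ e = {u, v, w} ∧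
        f u < f w ∧ f v < f w := by
      intro e he
      obtain ⟨u, v, w, huv, huw, hvw, rfl⟩ := Finset.card_eq_three.1 (F.card_eq e he)
      have := h.strict ⟨_, he, map_val_triple f huv huw hvw⟩
      rcases this with this | this | this
      · exact ⟨u, v, w, huv, huw, hvw, rfl, this⟩
      · exact ⟨u, w, v, huw, huv, hvw.symm, by grind, this⟩
      · exact ⟨v, w, u, hvw, huv.symm, huw.symm, by grind, this⟩
    refine ⟨?_, ?_, ?_⟩
    · intro e he
      obtain ⟨u, v, w, huv, huw, hvw, rfl, h₁, h₂⟩ := exists_top e he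
      exact ⟨w, by simp, by grind⟩
    · intro e he e' he' hsup
      obtain ⟨u, v, w, huv, huw, hvw, rfl, h₁, h₂⟩ := exists_top e he
      obtain ⟨u', v', w', huv', huw', hvw', rfl, h₁', h₂'⟩ := exists_top e' he'
      have hw : f w = f w' := by
        simp [Finset.sup_insert] at hsup
        omega
      have hm := map_val_triple f huv huw hvw
      have hm' := map_val_triple f huv' huw' hvw'
      have := h.top ⟨_, he, hm⟩ ⟨_, he', hw ▸ hm'⟩ h₁ h₂ (hw ▸ h₁') (hw ▸ h₂')
      rw [hm, hm', multiset_triple_eq_iff]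
      omega
    · rintro e he e' he' u v w u' v' w' huv huw hvw huv' huw' hvw' rfl rfl hu hv
      refine h.third ⟨_, he, map_val_triple f huv huw hvw⟩ ⟨_, he', ?_⟩
      rw [map_val_triple f huv' huw' hvw', hu, hv]

theorem IsLayeredValues.exists_insert {S : Set (Multiset ℕ)} (hS : IsLayeredValues S) (N : ℕ)
    (hN : ∀ s ∈ S, ∀ n ∈ s, n ≤ N) (a : ℕ) : ∃ b, IsLayeredValues (insert {b, a, a} S) := by
  by_cases hex : ∃ b, {b, a, a} ∈ S
  · obtain ⟨b, hb⟩ := hex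
    exact ⟨b, by rwa [Set.insert_eq_of_mem hb]⟩
  push Not at hex
  have hex' : ∀ b, {a, a, b} ∉ S := fun b hb => hex b (by
    rwa [(multiset_triple_eq_iff b a a a a b).2 (by simp)])
  have hle : ∀ {x y z : ℕ}, {x, y, z} ∈ S → x ≤ N ∧ y ≤ N ∧ z ≤ N := fun h =>
    ⟨hN _ h _ (by simp), hN _ h _ (by simp), hN _ h _ (by simp)⟩
  refine ⟨max a N + 1, ?_, ?_, ?_⟩
  · intro x y z h
    rcases h with h | h
    · rw [multiset_triple_eq_iff] at h
      omega
    · exact hS.strict h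
  · intro x y z x' y' h h' h₁ h₂ h₃ h₄
    rcases h with h | h <;> rcases h' with h' | h'
    · rw [multiset_triple_eq_iff] at h h'
      omega
    · rw [multiset_triple_eq_iff] at h
      have := hle h'
      omega
    · rw [multiset_triple_eq_iff] at h'
      have := hle h
      omega
    · exact hS.top h h' h₁ h₂ h₃ h₄
  · intro x y z z' h h'
    rcases h with h | h <;> rcases h' with h' | h'
    · rw [multiset_triple_eq_iff] at h h'
      omega
    · rw [multiset_triple_eq_iff] at h
      have := hle h'
      obtain ⟨rfl, rfl⟩ : x = a ∧ y = a := by omega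
      exact absurd h' (hex' z')
    · rw [multiset_triple_eq_iff] at h'
      have := hle h
      obtain ⟨rfl, rfl⟩ : x = a ∧ y = a := by omega
      exact absurd h (hex' z)
    · exact hS.third h h'

theorem triple_rotate {S : Set (Multiset ℕ)} {a b c : ℕ} (h : {a, b, c} ∈ S) : {b, c, a} ∈ S := by
  rwa [(multiset_triple_eq_iff b c a a b c).2 (by simp)]

theorem triple_swap {S : Set (Multiset ℕ)} {a b c : ℕ} (h : {a, b, c} ∈ S) : {a, c, b} ∈ S := by
  rwa [(multiset_triple_eq_iff a c b a b c).2 (by simp)]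

/-- Seven values whose triples along six lines of a Fano plane lie in `S`; the missing line is
`{X, Y, Z}`. -/
structure FanoValues (S : Set (Multiset ℕ)) (v x y z X Y Z : ℕ) : Prop where
  Xvx : {X, v, x} ∈ S
  Xyz : {X, y, z} ∈ S
  Yvy : {Y, v, y} ∈ S
  Yxz : {Y, x, z} ∈ S
  Zvz : {Z, v, z} ∈ S
  Zxy : {Z, x, y} ∈ S

namespace FanoValues

variable {S : Set (Multiset ℕ)} {v x y z X Y Z : ℕ}

theorem swap_xy (h : FanoValues S v x y z X Y Z) : FanoValues S v y x z Y X Z :=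
  ⟨h.Yvy, h.Yxz, h.Xvx, h.Xyz, h.Zvz, triple_swap h.Zxy⟩

theorem swap_xz (h : FanoValues S v x y z X Y Z) : FanoValues S v z y x Z Y X :=
  ⟨h.Zvz, triple_swap h.Zxy, h.Yvy, triple_swap h.Yxz, h.Xvx, triple_swap h.Xyz⟩

/-- Exchanging `v` with `x` and `y` with `z` fixes each of `X`, `Y`, `Z`. -/
theorem swap_vx (h : FanoValues S v x y z X Y Z) : FanoValues S x v z y X Y Z :=
  ⟨triple_swap h.Xvx, triple_swap h.Xyz, h.Yxz, h.Yvy, h.Zxy, h.Zvz⟩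

theorem not_top_v (hS : IsLayeredValues S) (h : FanoValues S v x y z X Y Z)
    (hx : x ≤ v) (hy : y ≤ v) (hz : z ≤ v) (hX : X ≤ v) (hY : Y ≤ v) (hZ : Z ≤ v) : False := by
  have h₁ := hS.strict h.Xvx
  have h₂ := hS.strict h.Yvy
  have h₃ := hS.strict h.Zvz
  have h₄ := hS.strict h.Xyz
  have h₅ := hS.strict h.Yxz
  have h₆ := hS.strict h.Zxy
  have t₁ := hS.top (triple_swap h.Xvx) (triple_swap h.Yvy) (by omega) (by omega) (by omega)
    (by omega)
  have t₂ := hS.top (triple_swap h.Xvx) (triple_swap h.Zvz) (by omega) (by omega) (by omega)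
    (by omega)
  have hyz : ¬(y = x ∧ z = x) := by
    rintro ⟨rfl, rfl⟩
    have := hS.third (triple_swap h.Xvx) h.Xyz
    omega
  omega

theorem eq_of_top_X (hS : IsLayeredValues S) (h : FanoValues S v x y z X Y Z)
    (hv : v ≤ X) (hx : x ≤ X) (hy : y ≤ X) (hz : z ≤ X) : x = v ∧ y = v ∧ z = v := by
  have h₁ := hS.strict h.Xvx
  have h₂ := hS.strict h.Xyz
  rcases hS.top (triple_rotate h.Xvx) (triple_rotate h.Xyz) (by omega) (by omega) (by omega)
    (by omega) with ⟨rfl, rfl⟩ | ⟨rfl, rfl⟩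
  · have h₃ := hS.strict h.Yvy
    have h₄ := hS.strict h.Yxz
    have := hS.top (triple_rotate h.Yvy) (triple_rotate h.Yxz) (by omega) (by omega) (by omega)
      (by omega)
    omega
  · have h₃ := hS.strict h.Zvz
    have h₄ := hS.strict h.Zxy
    have := hS.top (triple_rotate h.Zvz) (triple_rotate h.Zxy) (by omega) (by omega) (by omega)
      (by omega)
    omega

theorem eq_v (hS : IsLayeredValues S) (h : FanoValues S v x y z X Y Z) :
    x = v ∧ y = v ∧ z = v := by
  have hv := h.not_top_v hS
  have hx := h.swap_vx.not_top_v hS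
  have hy := h.swap_xy.swap_vx.not_top_v hS
  have hz := h.swap_xz.swap_vx.not_top_v hS
  have hX := h.eq_of_top_X hS
  have hY := h.swap_xy.eq_of_top_X hS
  have hZ := h.swap_xz.eq_of_top_X hS
  clear h
  grind

theorem mem_and_lt (hS : IsLayeredValues S) (h : FanoValues S v x y z X Y Z) :
    {v, v, X} ∈ S ∧ v < X := by
  obtain ⟨rfl, -, -⟩ := h.eq_v hS
  have := hS.strict h.Xvx
  exact ⟨triple_rotate h.Xvx, by omega⟩

theorem v_eq (hS : IsLayeredValues S) (h : FanoValues S v x y z X Y Z) {v' x' y' z' : ℕ}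
    (h' : FanoValues S v' x' y' z' X Y Z) : v = v' := by
  obtain ⟨hm, hlt⟩ := h.mem_and_lt hS
  obtain ⟨hm', hlt'⟩ := h'.mem_and_lt hS
  have := hS.top hm hm' hlt hlt hlt' hlt'
  omega

end FanoValues

section Linearization

variable [DecidableEq α] {F : ThreeGraph α} {v : α}

theorem map_image_inl (f : α → ℕ) (g : LinVert F v → ℕ)
    (hfg : ∀ u : {x : α // x ≠ v}, g (Sum.inl u) = f u) {p : Finset α} (hp : v ∉ p) :
    Multiset.map g ((p.subtype (fun x => x ≠ v)).image Sum.inl : Finset (LinVert F v)).val =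
      Multiset.map f p.val := by
  rw [Finset.image_val_of_injOn Sum.inl_injective.injOn, Multiset.map_map]
  have hsub : ((p.subtype (fun x => x ≠ v)).map (Function.Embedding.subtype _)) = p :=
    Finset.subtype_map_of_mem fun x hx hxv => hp (hxv ▸ hx)
  conv_rhs => rw [← hsub, Finset.map_val, Multiset.map_map]
  exact Multiset.map_congr rfl fun u _ => hfg u

theorem map_insert_image_inl (f : α → ℕ) (g : LinVert F v → ℕ)
    (hfg : ∀ u : {x : α // x ≠ v}, g (Sum.inl u) = f u) {e : Finset α} (he : v ∈ e)
    (p : {p : Finset α // p ∈ linkPairs F v}) (hpe : p.val = e.erase v)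
    (hg : g (Sum.inr (Sum.inl (0, p))) = f v) :
    Multiset.map g (insert (Sum.inr (Sum.inl (0, p)))
      ((p.val.subtype (fun x => x ≠ v)).image Sum.inl) : Finset (LinVert F v)).val =
      Multiset.map f e.val := by
  rw [Finset.insert_val_of_notMem (by simp), Multiset.map_cons,
    map_image_inl f g hfg (by simp [hpe]), hg, hpe]
  conv_rhs => rw [← Finset.insert_erase he]
  rw [Finset.insert_val_of_notMem (by simp), Multiset.map_cons]

theorem isLayered_linearization {G : ThreeGraph (LinVert F v)} (hG : IsLinearization F v G)
    (hF : IsLayered F) : IsLayered G := by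
  obtain ⟨f, hf⟩ := hF
  rw [isLayeredFunction_iff] at hf
  obtain ⟨b, hb⟩ := hf.exists_insert (F.edges.sup fun e => e.sup f) (by
    rintro s ⟨e, he, rfl⟩ n hn
    obtain ⟨u, hu, rfl⟩ := Multiset.mem_map.1 hn
    exact (Finset.le_sup (f := f) hu).trans (Finset.le_sup (f := fun e => e.sup f) he)) (f v)
  refine ⟨Sum.elim (fun u => f u) (Sum.elim (fun _ => f v) fun _ => b), ?_⟩
  rw [isLayeredFunction_iff]
  refine hb.mono ?_
  rintro s ⟨e, he, rfl⟩
  rcases (hG e).1 he with ⟨e₀, he₀, hv, rfl⟩ | ⟨p, rfl | hp⟩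
  · exact Or.inr ⟨e₀, he₀, (map_image_inl f _ (fun _ => rfl) hv).symm⟩
  · obtain ⟨e₀, he₀, hp⟩ := Finset.mem_image.1 p.2
    rw [Finset.mem_filter] at he₀
    exact Or.inr ⟨e₀, he₀.1,
      (map_insert_image_inl f _ (fun _ => rfl) he₀.2 p hp.symm rfl).symm⟩
  · left
    rcases hp with rfl | rfl | rfl | rfl | rfl | rfl <;>
    · rw [map_val_triple _ (by simp) (by simp) (by simp)]
      simp

theorem IsLinearization.fanoValues {G : ThreeGraph (LinVert F v)} (hG : IsLinearization F v G)
    (g : LinVert F v → ℕ) (p : {p : Finset α // p ∈ linkPairs F v}) :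
    FanoValues (edgeValues G.edges g) (g (Sum.inr (Sum.inl (0, p))))
      (g (Sum.inr (Sum.inl (1, p)))) (g (Sum.inr (Sum.inl (2, p))))
      (g (Sum.inr (Sum.inl (3, p)))) (g (Sum.inr (Sum.inr 0))) (g (Sum.inr (Sum.inr 1)))
      (g (Sum.inr (Sum.inr 2))) := by
  constructor <;>
    exact ⟨_, (hG _).2 (Or.inr ⟨p, by tauto⟩), map_val_triple g (by simp) (by simp) (by simp)⟩

theorem isLayered_of_linearization {G : ThreeGraph (LinVert F v)} (hG : IsLinearization F v G)
    (hL : IsLayered G) : IsLayered F := by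
  obtain ⟨g, hg⟩ := hL
  rw [isLayeredFunction_iff] at hg
  obtain ⟨a, ha⟩ : ∃ a, ∀ p, g (Sum.inr (Sum.inl (0, p))) = a := by
    rcases isEmpty_or_nonempty {p : Finset α // p ∈ linkPairs F v} with hE | ⟨⟨q⟩⟩
    · exact ⟨0, fun p => hE.elim p⟩
    · exact ⟨_, fun p => (hG.fanoValues g p).v_eq hg (hG.fanoValues g q)⟩
  let f : α → ℕ := fun u => if hu : u ≠ v then g (Sum.inl ⟨u, hu⟩) else a
  have hfg : ∀ u : {x : α // x ≠ v}, g (Sum.inl u) = f u := fun u => by simp [f, u.2]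
  have hfv : f v = a := by simp [f]
  refine ⟨f, (isLayeredFunction_iff F f).2 (hg.mono ?_)⟩
  rintro s ⟨e, he, rfl⟩
  by_cases hv : v ∈ e
  · have hp : e.erase v ∈ linkPairs F v :=
      Finset.mem_image_of_mem _ (Finset.mem_filter.2 ⟨he, hv⟩)
    exact ⟨_, (hG _).2 (Or.inr ⟨⟨_, hp⟩, Or.inl rfl⟩),
      map_insert_image_inl f g hfg hv ⟨_, hp⟩ rfl ((ha _).trans hfv.symm)⟩
  · exact ⟨_, (hG _).2 (Or.inl ⟨e, he, hv, rfl⟩), map_image_inl f g hfg hv⟩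

end Linearization

/-- `F` is layered if and only if the linearization `F_v` is layered. -/
theorem stmt16 {α : Type} [Fintype α] [DecidableEq α] (F : ThreeGraph α) (v : α)
    (G : ThreeGraph (LinVert F v)) (hG : IsLinearization F v G) :
    IsLayered F ↔ IsLayered G :=
  ⟨isLayered_linearization hG, isLayered_of_linearization hG⟩
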